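/- arXiv:1512.07573 — 2 statements merged into one kernel-verified Lean document; each statement's English description precedes it below -/
import Mathlib

section
/- A simplicial object X in a category C is a decomposition object if and only if the following squares are all pullbacks: (i) the square with top edge s_1 : X_1 → X_2, left edge d_⊥ : X_1 → X_0, right edge d_⊥ : X_2 → X_1, and bottom edge s_0 : X_0 → X_1; (ii) the square with top edge s_0 : X_1 → X_2, left edge d_⊤ : X_1 → X_0, right edge d_⊤ : X_2 → X_1, and bottom edge s_0 : X_0 → X_1; and, for each n ≥ 2 and some choice of i = i_n with 0 < i < n: (iii) the square with top edge d_{1+i} : X_{1+n} → X_n, vertical edges d_⊥, and bottom edge d_i : X_n → X_{n−1}; and (iv) the square with top edge d_i : X_{n+1} → X_n, vertical edges d_⊤, and bottom edge d_i : X_n → X_{n−1}. -/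
open CategoryTheory CategoryTheory.Limits Simplicial Opposite

/-- A morphism of the simplex category is *active* (generic) if it preserves endpoints. -/
def IsActive {x y : SimplexCategory} (f : x ⟶ y) : Prop :=
  f.toOrderHom 0 = 0 ∧ f.toOrderHom (Fin.last x.len) = Fin.last y.len

/-- A morphism of the simplex category is *inert* (free) if it is distance-preserving. -/
def IsInert {x y : SimplexCategory} (f : x ⟶ y) : Prop :=
  ∀ i : Fin x.len, (f.toOrderHom i.succ : ℕ) = (f.toOrderHom i.castSucc : ℕ) + 1

variable {C : Type*} [Category C]

/-- A simplicial object is a *decomposition object* if it sends every pushout in `Δ` of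
an active map along an inert map to a pullback square. -/
def IsDecomp (X : SimplicialObject C) : Prop :=
  ∀ ⦃n m k p : SimplexCategory⦄ (f : n ⟶ m) (g : n ⟶ k) (r : m ⟶ p) (s : k ⟶ p),
    IsInert f → IsActive g → IsPushout f g r s →
    IsPullback (X.map r.op) (X.map s.op) (X.map f.op) (X.map g.op)

/-- Extend a monotone map on `Fin n` to `Fin (n + 1)` by an upper bound of its values. -/
def OrderHom.finSnoc {n : ℕ} {α : Type*} [Preorder α] (f : Fin n →o α) (a : α)
    (h : ∀ i, f i ≤ a) : Fin (n + 1) →o α where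
  toFun := Fin.lastCases a f
  monotone' i j hij := by
    cases j using Fin.lastCases with
    | last =>
      cases i using Fin.lastCases with
      | last => exact le_rfl
      | cast i => simpa using h i
    | cast j =>
      cases i using Fin.lastCases with
      | last => exact absurd hij (not_le.2 (Fin.castSucc_lt_last j))
      | cast i => simpa using f.monotone (Fin.castSucc_le_castSucc_iff.1 hij)

theorem OrderHom.finSnoc_last {n : ℕ} {α : Type*} [Preorder α] (f : Fin n →o α) (a : α)
    (h : ∀ i, f i ≤ a) : f.finSnoc a h (Fin.last n) = a :=
  Fin.lastCases_last (motive := fun _ => α)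

theorem OrderHom.finSnoc_castSucc {n : ℕ} {α : Type*} [Preorder α] (f : Fin n →o α) (a : α)
    (h : ∀ i, f i ≤ a) (i : Fin n) : f.finSnoc a h i.castSucc = f i :=
  Fin.lastCases_castSucc (motive := fun _ => α) i

/-- Extend a monotone map on `Fin n` to `Fin (n + 1)` by a lower bound of its values. -/
def OrderHom.finCons {n : ℕ} {α : Type*} [Preorder α] (a : α) (f : Fin n →o α)
    (h : ∀ i, a ≤ f i) : Fin (n + 1) →o α where
  toFun := Fin.cases a f
  monotone' i j hij := by
    cases i using Fin.cases with
    | zero =>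
      cases j using Fin.cases with
      | zero => exact le_rfl
      | succ j => exact h j
    | succ i =>
      cases j using Fin.cases with
      | zero => simp at hij
      | succ j => exact f.monotone (Fin.succ_le_succ_iff.1 hij)

namespace SimplexCategory

theorem hom_ext_apply {x y : SimplexCategory} {f g : x ⟶ y}
    (h : ∀ i, f.toOrderHom i = g.toOrderHom i) : f = g :=
  Hom.ext _ _ (OrderHom.ext _ _ (funext h))

/-- The endofunctor of `Δ` adjoining a new bottom element, `[n] ↦ [1] ∨ [n]`. -/
def extendBot : SimplexCategory ⥤ SimplexCategory where
  obj x := ⦋x.len + 1⦌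
  map {_ _} f := mkHom (OrderHom.finCons 0 ((Fin.succOrderEmb _).toOrderHom.comp f.toOrderHom)
    fun _ => Fin.zero_le _)
  map_id x := hom_ext_apply fun i => by
    cases i using Fin.cases <;> rfl
  map_comp f g := hom_ext_apply fun i => by
    cases i using Fin.cases <;> rfl

/-- The map `f ∨ id : [n] ∨ [1] → [k] ∨ [1]` induced by `f : [n] → [k]`. -/
def extendTopMap {x y : SimplexCategory} (f : x ⟶ y) : ⦋x.len + 1⦌ ⟶ ⦋y.len + 1⦌ :=
  mkHom (OrderHom.finSnoc (Fin.castSuccOrderEmb.toOrderHom.comp f.toOrderHom)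
    (Fin.last _) fun _ => Fin.le_last _)

theorem extendTopMap_last {x y : SimplexCategory} (f : x ⟶ y) :
    (extendTopMap f).toOrderHom (Fin.last (x.len + 1)) = Fin.last (y.len + 1) :=
  OrderHom.finSnoc_last _ _ fun _ => Fin.le_last _

theorem extendTopMap_castSucc {x y : SimplexCategory} (f : x ⟶ y) (i : Fin (x.len + 1)) :
    (extendTopMap f).toOrderHom i.castSucc = (f.toOrderHom i).castSucc :=
  OrderHom.finSnoc_castSucc _ _ (fun _ => Fin.le_last _) i

/-- The endofunctor of `Δ` adjoining a new top element, `[n] ↦ [n] ∨ [1]`. -/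
def extendTop : SimplexCategory ⥤ SimplexCategory where
  obj x := ⦋x.len + 1⦌
  map f := extendTopMap f
  map_id x := hom_ext_apply fun i => by
    cases i using Fin.lastCases with
    | last => exact extendTopMap_last _
    | cast i => exact extendTopMap_castSucc _ i
  map_comp f g := hom_ext_apply fun i => by
    cases i using Fin.lastCases with
    | last =>
      exact (extendTopMap_last _).trans
        ((congrArg _ (extendTopMap_last f)).trans (extendTopMap_last g)).symm
    | cast i =>
      exact (extendTopMap_castSucc _ i).trans
        ((congrArg _ (extendTopMap_castSucc f i)).trans (extendTopMap_castSucc g _)).symm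

theorem extendBot_map_succ {x y : SimplexCategory} (f : x ⟶ y) (i : Fin (x.len + 1)) :
    (extendBot.map f).toOrderHom i.succ = (f.toOrderHom i).succ := rfl

theorem extendTop_map_last {x y : SimplexCategory} (f : x ⟶ y) :
    (extendTop.map f).toOrderHom (Fin.last (x.len + 1)) = Fin.last (y.len + 1) :=
  extendTopMap_last f

theorem extendTop_map_castSucc {x y : SimplexCategory} (f : x ⟶ y) (i : Fin (x.len + 1)) :
    (extendTop.map f).toOrderHom i.castSucc = (f.toOrderHom i).castSucc :=
  extendTopMap_castSucc f i

/-- The natural inclusion `[n] → [1] ∨ [n]`. -/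
def toExtendBot : 𝟭 SimplexCategory ⟶ extendBot where
  app x := δ (n := x.len) 0
  naturality _ _ _ := rfl

/-- The natural inclusion `[n] → [n] ∨ [1]`. -/
def toExtendTop : 𝟭 SimplexCategory ⟶ extendTop where
  app x := δ (n := x.len) (Fin.last _)
  naturality x y f := hom_ext_apply fun i => by
    refine (Fin.succAbove_last_apply (f.toOrderHom i)).trans (Eq.symm ?_)
    exact (congrArg (extendTop.map f).toOrderHom (Fin.succAbove_last_apply i)).trans
      (extendTop_map_castSucc f i)

theorem toExtendBot_app_apply (x : SimplexCategory) (i : Fin (x.len + 1)) :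
    (toExtendBot.app x).toOrderHom i = i.succ := rfl

theorem toExtendTop_app_apply (x : SimplexCategory) (i : Fin (x.len + 1)) :
    (toExtendTop.app x).toOrderHom i = i.castSucc :=
  Fin.succAbove_last_apply i

theorem isInert_toExtendBot (x : SimplexCategory) : IsInert (toExtendBot.app x) := fun i => by
  simp only [toExtendBot_app_apply]
  rfl

theorem isInert_toExtendTop (x : SimplexCategory) : IsInert (toExtendTop.app x) := fun i => by
  simp only [toExtendTop_app_apply]
  rfl

theorem isActive_extendBot_map {x y : SimplexCategory} {g : x ⟶ y} (hg : IsActive g) :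
    IsActive (extendBot.map g) :=
  ⟨rfl, by
    change (extendBot.map g).toOrderHom (Fin.last x.len).succ = (Fin.last y.len).succ
    rw [extendBot_map_succ, hg.2]⟩

theorem isActive_extendTop_map {x y : SimplexCategory} {g : x ⟶ y} (hg : IsActive g) :
    IsActive (extendTop.map g) :=
  ⟨by
    change (extendTop.map g).toOrderHom (0 : Fin (x.len + 1)).castSucc =
      (0 : Fin (y.len + 1)).castSucc
    rw [extendTop_map_castSucc, hg.1], extendTop_map_last g⟩

theorem isPushout_extendBot {x y : SimplexCategory} {g : x ⟶ y} (hg : IsActive g) :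
    IsPushout (toExtendBot.app x) g (extendBot.map g) (toExtendBot.app y) where
  w := (toExtendBot.naturality g).symm
  isColimit' := ⟨PushoutCocone.IsColimit.mk _
    (fun s => mkHom (OrderHom.finCons (s.inl.toOrderHom 0) s.inr.toOrderHom fun i => by
      have hs : s.inl.toOrderHom (0 : Fin (x.len + 1)).succ = s.inr.toOrderHom 0 := by
        rw [← hg.1]
        exact congrArg (fun f : x ⟶ s.pt => f.toOrderHom 0) s.condition
      exact (s.inl.toOrderHom.monotone (Fin.zero_le _)).trans
        (hs.le.trans (s.inr.toOrderHom.monotone (Fin.zero_le i)))))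
    (fun s => hom_ext_apply fun i => by
      cases i using Fin.cases with
      | zero => rfl
      | succ i =>
        exact (congrArg (fun f : x ⟶ s.pt => f.toOrderHom i) s.condition).symm)
    (fun s => hom_ext_apply fun i => rfl)
    (fun s m h₁ h₂ => hom_ext_apply fun i => by
      cases i using Fin.cases with
      | zero => exact congrArg (fun f : extendBot.obj x ⟶ s.pt => f.toOrderHom 0) h₁
      | succ i => exact congrArg (fun f : y ⟶ s.pt => f.toOrderHom i) h₂)⟩

theorem isPushout_extendTop {x y : SimplexCategory} {g : x ⟶ y} (hg : IsActive g) :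
    IsPushout (toExtendTop.app x) g (extendTop.map g) (toExtendTop.app y) where
  w := (toExtendTop.naturality g).symm
  isColimit' := by
    have key (s : PushoutCocone (toExtendTop.app x) g) (i : Fin (x.len + 1)) :
        s.inl.toOrderHom i.castSucc = s.inr.toOrderHom (g.toOrderHom i) := by
      rw [← toExtendTop_app_apply]
      exact congrArg (fun f : x ⟶ s.pt => f.toOrderHom i) s.condition
    have le (s : PushoutCocone (toExtendTop.app x) g) (i : Fin (y.len + 1)) :
        s.inr.toOrderHom i ≤ s.inl.toOrderHom (Fin.last (x.len + 1)) := by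
      refine (s.inr.toOrderHom.monotone (Fin.le_last i)).trans ?_
      rw [← hg.2, ← key]
      exact s.inl.toOrderHom.monotone (Fin.le_last _)
    let d (s : PushoutCocone (toExtendTop.app x) g) : extendTop.obj y ⟶ s.pt :=
      mkHom (OrderHom.finSnoc s.inr.toOrderHom (s.inl.toOrderHom (Fin.last (x.len + 1))) (le s))
    have d_last (s) : (d s).toOrderHom (Fin.last (y.len + 1)) =
        s.inl.toOrderHom (Fin.last (x.len + 1)) := OrderHom.finSnoc_last _ _ (le s)
    have d_castSucc (s) (i : Fin (y.len + 1)) :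
        (d s).toOrderHom i.castSucc = s.inr.toOrderHom i :=
      OrderHom.finSnoc_castSucc _ _ (le s) i
    refine ⟨PushoutCocone.IsColimit.mk _ d (fun s => hom_ext_apply fun i => ?_)
      (fun s => hom_ext_apply fun i => ?_) (fun s m h₁ h₂ => hom_ext_apply fun i => ?_)⟩
    · change (d s).toOrderHom ((extendTop.map g).toOrderHom i) = _
      cases i using Fin.lastCases with
      | last => exact (congrArg _ (extendTop_map_last g)).trans (d_last s)
      | cast i =>
        exact (congrArg _ (extendTop_map_castSucc g i)).trans ((d_castSucc s _).trans (key s i).symm)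
    · change (d s).toOrderHom ((toExtendTop.app y).toOrderHom i) = _
      rw [toExtendTop_app_apply, d_castSucc]
    · cases i using Fin.lastCases with
      | last =>
        refine Eq.trans ?_ (d_last s).symm
        rw [← h₁]
        exact (congrArg m.toOrderHom (extendTop_map_last g)).symm
      | cast i =>
        refine Eq.trans ?_ (d_castSucc s i).symm
        rw [← h₂]
        exact (congrArg m.toOrderHom (toExtendTop_app_apply y i)).symm

theorem extendBot_map_δ {n : ℕ} (i : Fin (n + 2)) : extendBot.map (δ i) = δ i.succ :=
  hom_ext_apply fun j => by
    cases j using Fin.cases with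
    | zero => exact (Fin.succ_succAbove_zero i).symm
    | succ j => exact (Fin.succ_succAbove_succ i j).symm

theorem extendTop_map_δ {n : ℕ} (i : Fin (n + 2)) : extendTop.map (δ i) = δ i.castSucc :=
  hom_ext_apply fun j => by
    cases j using Fin.lastCases with
    | last =>
      refine (extendTop_map_last _).trans ?_
      exact (Fin.succAbove_ne_last_last (Fin.castSucc_lt_last i).ne).symm
    | cast j =>
      refine (extendTop_map_castSucc _ _).trans ?_
      exact (Fin.castSucc_succAbove_castSucc (i := i) (j := j)).symm

theorem extendBot_map_σ_zero : extendBot.map (σ (0 : Fin 1)) = σ (1 : Fin 2) :=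
  hom_ext_apply (by decide)

theorem extendTop_map_σ_zero : extendTop.map (σ (0 : Fin 1)) = σ (0 : Fin 2) :=
  hom_ext_apply (by decide)

theorem eq_of_isActive_of_len_eq_one {x : SimplexCategory} {f g : ⦋1⦌ ⟶ x}
    (hf : IsActive f) (hg : IsActive g) : f = g :=
  hom_ext_apply fun i => by
    match i with
    | 0 => exact hf.1.trans hg.1.symm
    | 1 => exact hf.2.trans hg.2.symm

theorem isActive_id (x : SimplexCategory) : IsActive (𝟙 x) := ⟨rfl, rfl⟩

theorem _root_.IsActive.comp {x y z : SimplexCategory} {f : x ⟶ y} {g : y ⟶ z} (hf : IsActive f)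
    (hg : IsActive g) : IsActive (f ≫ g) :=
  ⟨(congrArg g.toOrderHom hf.1).trans hg.1, (congrArg g.toOrderHom hf.2).trans hg.2⟩

theorem isActive_δ {n : ℕ} (i : Fin (n + 2)) (h₀ : i ≠ 0) (h₁ : i ≠ Fin.last (n + 1)) :
    IsActive (δ i) :=
  ⟨Fin.succAbove_ne_zero_zero h₀, Fin.succAbove_ne_last_last h₁⟩

theorem isActive_σ_zero : IsActive (σ (0 : Fin 1)) := by
  constructor <;> decide

/-- A left-cancellative, multiplicative class of maps of `Δ` contains all the active maps as soon
as it contains `s^0 : [1] → [0]` and one inner coface map `[n] → [n + 1]` for each `n ≥ 1`. -/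
theorem of_isActive (P : MorphismProperty SimplexCategory) [P.IsMultiplicative]
    (hP : ∀ ⦃x y z : SimplexCategory⦄ (f : x ⟶ y) (g : y ⟶ z), P f → P (f ≫ g) → P g)
    (hσ : P (σ (0 : Fin 1)))
    (hδ : ∀ m : ℕ, ∃ i : Fin (m + 3), i ≠ 0 ∧ i ≠ Fin.last (m + 2) ∧ P (δ i))
    {x y : SimplexCategory} (g : x ⟶ y) (hg : IsActive g) : P g := by
  have exists_active (n : ℕ) : ∃ f : ⦋1⦌ ⟶ ⦋n⦌, IsActive f ∧ P f := by
    match n with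
    | 0 => exact ⟨_, isActive_σ_zero, hσ⟩
    | n + 1 =>
      induction n with
      | zero => exact ⟨𝟙 _, isActive_id _, P.id_mem _⟩
      | succ n ih =>
        obtain ⟨f, hf, hPf⟩ := ih
        obtain ⟨i, h₀, h₁, hi⟩ := hδ n
        exact ⟨f ≫ δ i, hf.comp (isActive_δ i h₀ h₁), P.comp_mem _ _ hPf hi⟩
  obtain ⟨f, hf, hPf⟩ := exists_active x.len
  obtain ⟨f', hf', hPf'⟩ := exists_active y.len
  refine hP f g hPf ?_
  rwa [eq_of_isActive_of_len_eq_one (hf.comp hg) hf']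

theorem exists_eq_comp_toExtendBot {x : SimplexCategory} {m : ℕ} {f : x ⟶ ⦋m + 1⦌}
    (hf : IsInert f) (h : f.toOrderHom 0 ≠ 0) :
    ∃ f' : x ⟶ ⦋m⦌, IsInert f' ∧ f = f' ≫ toExtendBot.app ⦋m⦌ := by
  obtain ⟨f', rfl⟩ := eq_comp_δ_of_not_surjective' f 0 fun i hi =>
    h (Fin.le_zero_iff.1 (hi ▸ f.toOrderHom.monotone (Fin.zero_le i)))
  refine ⟨f', fun i => ?_, rfl⟩
  have := hf i
  change ((f'.toOrderHom i.succ).succ : ℕ) = ((f'.toOrderHom i.castSucc).succ : ℕ) + 1 at this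
  simpa using this

theorem exists_eq_comp_toExtendTop {x : SimplexCategory} {m : ℕ} {f : x ⟶ ⦋m + 1⦌}
    (hf : IsInert f) (h : f.toOrderHom (Fin.last x.len) ≠ Fin.last (m + 1)) :
    ∃ f' : x ⟶ ⦋m⦌, IsInert f' ∧ f = f' ≫ toExtendTop.app ⦋m⦌ := by
  obtain ⟨f', rfl⟩ := eq_comp_δ_of_not_surjective' f (Fin.last _) fun i hi =>
    h (Fin.last_le_iff.1 (hi ▸ f.toOrderHom.monotone (Fin.le_last i)))
  refine ⟨f', fun i => ?_, rfl⟩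
  have := hf i
  change (((toExtendTop.app ⦋m⦌).toOrderHom (f'.toOrderHom i.succ) : Fin (m + 2)) : ℕ) =
    ((toExtendTop.app ⦋m⦌).toOrderHom (f'.toOrderHom i.castSucc) : Fin (m + 2)) + 1 at this
  simpa [toExtendTop_app_apply] using this

theorem _root_.IsInert.apply_eq {x y : SimplexCategory} {f : x ⟶ y} (hf : IsInert f)
    (i : Fin (x.len + 1)) : (f.toOrderHom i : ℕ) = f.toOrderHom 0 + i := by
  induction i using Fin.induction with
  | zero => simp
  | succ i ih => rw [hf i, ih]; simp [add_assoc]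

theorem _root_.IsInert.exists_eqToHom_of_isActive {x y : SimplexCategory} {f : x ⟶ y} (hf : IsInert f)
    (hf' : IsActive f) : ∃ h : x = y, f = eqToHom h := by
  have hlen : x.len = y.len := by
    have := hf.apply_eq (Fin.last _)
    rw [hf'.1, hf'.2] at this
    simpa using this.symm
  obtain rfl : x = y := SimplexCategory.ext hlen
  refine ⟨rfl, hom_ext_apply fun i => Fin.ext ?_⟩
  rw [hf.apply_eq, hf'.1]
  simp

end SimplexCategory

open SimplexCategory

/-- The maps whose naturality square for `η` is sent to a pullback square by `X`. -/
def pullbackNaturality (X : SimplicialObject C) {E : SimplexCategory ⥤ SimplexCategory}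
    (η : 𝟭 SimplexCategory ⟶ E) : MorphismProperty SimplexCategory := fun x y g =>
  IsPullback (X.map (E.map g).op) (X.map (η.app y).op) (X.map (η.app x).op) (X.map g.op)

section

variable (X : SimplicialObject C) {E : SimplexCategory ⥤ SimplexCategory}
  (η : 𝟭 SimplexCategory ⟶ E)

instance : (pullbackNaturality X η).IsMultiplicative where
  id_mem x := by
    dsimp only [pullbackNaturality]
    simpa using IsPullback.of_id_fst
  comp_mem f g hf hg := by
    dsimp only [pullbackNaturality]
    simpa using hg.paste_horiz hf

theorem pullbackNaturality_of_comp {x y z : SimplexCategory} (f : x ⟶ y) (g : y ⟶ z)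
    (hf : pullbackNaturality X η f) (hfg : pullbackNaturality X η (f ≫ g)) :
    pullbackNaturality X η g := by
  dsimp only [pullbackNaturality] at hfg
  simp only [Functor.map_comp, op_comp] at hfg
  refine IsPullback.of_right hfg ?_ hf
  simp only [← X.map_comp, ← op_comp]
  exact congrArg (fun f => X.map f.op) (η.naturality g).symm

end

theorem isDecomp_of_pullbackNaturality (X : SimplicialObject C)
    (hbot : ∀ ⦃x y : SimplexCategory⦄ (g : x ⟶ y), IsActive g → pullbackNaturality X toExtendBot g)
    (htop : ∀ ⦃x y : SimplexCategory⦄ (g : x ⟶ y), IsActive g → pullbackNaturality X toExtendTop g) :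
    IsDecomp X := by
  have of_active ⦃n m k : SimplexCategory⦄ (f : n ⟶ m) (g : n ⟶ k) (hf : IsInert f)
      (hf' : IsActive f) (hg : IsActive g) : ∃ (p : SimplexCategory) (r : m ⟶ p) (s : k ⟶ p),
        IsActive r ∧ IsPushout f g r s ∧
          IsPullback (X.map r.op) (X.map s.op) (X.map f.op) (X.map g.op) := by
    obtain ⟨rfl, rfl⟩ := hf.exists_eqToHom_of_isActive hf'
    exact ⟨k, g, 𝟙 k, hg, IsPushout.of_id_fst, by simpa using IsPullback.of_id_snd⟩
  have key (m : ℕ) ⦃n k : SimplexCategory⦄ (f : n ⟶ ⦋m⦌) (g : n ⟶ k) (hf : IsInert f)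
      (hg : IsActive g) : ∃ (p : SimplexCategory) (r : ⦋m⦌ ⟶ p) (s : k ⟶ p), IsActive r ∧
        IsPushout f g r s ∧ IsPullback (X.map r.op) (X.map s.op) (X.map f.op) (X.map g.op) := by
    induction m generalizing n k with
    | zero => exact of_active f g hf ⟨Subsingleton.elim (α := Fin 1) _ _,
        Subsingleton.elim (α := Fin 1) _ _⟩ hg
    | succ m ih =>
      by_cases h₀ : f.toOrderHom 0 = 0
      · by_cases h₁ : f.toOrderHom (Fin.last n.len) = Fin.last (m + 1)
        · exact of_active f g hf ⟨h₀, h₁⟩ hg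
        · obtain ⟨f', hf', rfl⟩ := exists_eq_comp_toExtendTop hf h₁
          obtain ⟨p, r, s, hr, hp, hX⟩ := ih f' g hf' hg
          refine ⟨_, _, _, isActive_extendTop_map hr, hp.paste_horiz (isPushout_extendTop hr), ?_⟩
          have := (htop r hr).paste_vert hX
          simp only [← X.map_comp, ← op_comp] at this
          exact this
      · obtain ⟨f', hf', rfl⟩ := exists_eq_comp_toExtendBot hf h₀
        obtain ⟨p, r, s, hr, hp, hX⟩ := ih f' g hf' hg
        refine ⟨_, _, _, isActive_extendBot_map hr, hp.paste_horiz (isPushout_extendBot hr), ?_⟩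
        have := (hbot r hr).paste_vert hX
        simp only [← X.map_comp, ← op_comp] at this
        exact this
  intro n m k p f g r s hf hg hp
  obtain ⟨p', r', s', -, hp', hX⟩ := key m.len f g hf hg
  let e := hp.isoIsPushout _ _ hp'
  refine IsPullback.of_iso hX (X.mapIso e.op) (Iso.refl _) (Iso.refl _) (Iso.refl _) ?_ ?_ ?_ ?_
  · simp [e, ← X.map_comp, ← op_comp]
  · simp [e, ← X.map_comp, ← op_comp]
  · simp
  · simp

theorem pullbackNaturality_toExtendBot_σ_zero_iff (X : SimplicialObject C) :
    pullbackNaturality X toExtendBot (σ (0 : Fin 1)) ↔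
      IsPullback (X.σ (1 : Fin 2)) (X.δ (0 : Fin 2)) (X.δ (0 : Fin 3)) (X.σ (0 : Fin 1)) := by
  dsimp only [pullbackNaturality]
  rw [extendBot_map_σ_zero]
  rfl

theorem pullbackNaturality_toExtendTop_σ_zero_iff (X : SimplicialObject C) :
    pullbackNaturality X toExtendTop (σ (0 : Fin 1)) ↔
      IsPullback (X.σ (0 : Fin 2)) (X.δ (1 : Fin 2)) (X.δ (2 : Fin 3)) (X.σ (0 : Fin 1)) := by
  dsimp only [pullbackNaturality]
  rw [extendTop_map_σ_zero]
  rfl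

theorem pullbackNaturality_toExtendBot_δ_iff (X : SimplicialObject C) {n : ℕ} (i : Fin (n + 2)) :
    pullbackNaturality X toExtendBot (δ i) ↔
      IsPullback (X.δ i.succ) (X.δ 0) (X.δ 0) (X.δ i) := by
  dsimp only [pullbackNaturality]
  rw [extendBot_map_δ]
  rfl

theorem pullbackNaturality_toExtendTop_δ_iff (X : SimplicialObject C) {n : ℕ} (i : Fin (n + 2)) :
    pullbackNaturality X toExtendTop (δ i) ↔
      IsPullback (X.δ i.castSucc) (X.δ (Fin.last _)) (X.δ (Fin.last _)) (X.δ i) := by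
  dsimp only [pullbackNaturality]
  rw [extendTop_map_δ]
  rfl

/-- A simplicial object `X` is a decomposition object if and only if the squares
(i) `(s_1, d_⊥; d_⊥, s_0)`, (ii) `(s_0, d_⊤; d_⊤, s_0)` are pullbacks and, for each
`n ≥ 2` (here `n = m+2`) and some choice of `i` with `0 < i < n`, the squares
(iii) `(d_{1+i}, d_⊥; d_⊥, d_i)` and (iv) `(d_i, d_⊤; d_⊤, d_i)` are pullbacks. -/
theorem isDecomp_iff_four_diagrams (X : SimplicialObject C) :
    IsDecomp X ↔
      (IsPullback (X.σ (1 : Fin 2)) (X.δ (0 : Fin 2)) (X.δ (0 : Fin 3)) (X.σ (0 : Fin 1)) ∧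
       IsPullback (X.σ (0 : Fin 2)) (X.δ (1 : Fin 2)) (X.δ (2 : Fin 3)) (X.σ (0 : Fin 1)) ∧
       ∀ m : ℕ, ∃ (i : ℕ) (_ : 0 < i) (_ : i < m + 2),
         IsPullback (X.δ (⟨i + 1, by omega⟩ : Fin (m + 4))) (X.δ (0 : Fin (m + 4)))
           (X.δ (0 : Fin (m + 3))) (X.δ (⟨i, by omega⟩ : Fin (m + 3))) ∧
         IsPullback (X.δ (⟨i, by omega⟩ : Fin (m + 4))) (X.δ (Fin.last (m + 3)))
           (X.δ (Fin.last (m + 2))) (X.δ (⟨i, by omega⟩ : Fin (m + 3)))) := by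
  constructor
  · intro h
    have hbot {x y : SimplexCategory} (g : x ⟶ y) (hg : IsActive g) :
        pullbackNaturality X toExtendBot g :=
      h _ _ _ _ (isInert_toExtendBot x) hg (isPushout_extendBot hg)
    have htop {x y : SimplexCategory} (g : x ⟶ y) (hg : IsActive g) :
        pullbackNaturality X toExtendTop g :=
      h _ _ _ _ (isInert_toExtendTop x) hg (isPushout_extendTop hg)
    have hδ (m : ℕ) : IsActive (δ (1 : Fin (m + 3))) :=
      isActive_δ _ (by simp) (by simp [Fin.ext_iff])
    refine ⟨(pullbackNaturality_toExtendBot_σ_zero_iff X).1 (hbot _ isActive_σ_zero),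
      (pullbackNaturality_toExtendTop_σ_zero_iff X).1 (htop _ isActive_σ_zero),
      fun m => ⟨1, by omega, by omega, ?_, ?_⟩⟩
    · exact (pullbackNaturality_toExtendBot_δ_iff X _).1 (hbot _ (hδ m))
    · exact (pullbackNaturality_toExtendTop_δ_iff X _).1 (htop _ (hδ m))
  · rintro ⟨hbot, htop, h⟩
    refine isDecomp_of_pullbackNaturality X
      (fun _ _ g => of_isActive _ (fun _ _ _ => pullbackNaturality_of_comp X _)
        ((pullbackNaturality_toExtendBot_σ_zero_iff X).2 hbot) (fun m => ?_) g)
      (fun _ _ g => of_isActive _ (fun _ _ _ => pullbackNaturality_of_comp X _)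
        ((pullbackNaturality_toExtendTop_σ_zero_iff X).2 htop) (fun m => ?_) g)
    · obtain ⟨i, h₀, h₁, hi, -⟩ := h m
      exact ⟨⟨i, by omega⟩, by simpa [Fin.ext_iff] using h₀.ne',
        by simpa [Fin.ext_iff] using h₁.ne, (pullbackNaturality_toExtendBot_δ_iff X _).2 hi⟩
    · obtain ⟨i, h₀, h₁, -, hi⟩ := h m
      exact ⟨⟨i, by omega⟩, by simpa [Fin.ext_iff] using h₀.ne',
        by simpa [Fin.ext_iff] using h₁.ne, (pullbackNaturality_toExtendTop_δ_iff X _).2 hi⟩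
end

section
/- Let X be a decomposition object in a category C. Then for all i < j (whenever the indicated degeneracy maps are defined) the square with top edge s_{j−1} : X_n → X_{n+1}, left edge s_i : X_n → X_{n+1}, right edge s_i : X_{n+1} → X_{n+2}, and bottom edge s_j : X_{n+1} → X_{n+2} is a pullback. -/
open CategoryTheory CategoryTheory.Limits Simplicial Opposite

variable {C : Type*} [Category C]

/-- The codegeneracy `σ i` is the pushout of `⦋1⦌ ⟶ ⦋0⦌` along the inert map
`⦋1⦌ ⟶ ⦋n + 1⦌` whose image is `{i, i + 1}`. -/
theorem isPushout_mkOfSucc_σ {n : ℕ} (i : Fin (n + 1)) :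
    IsPushout (SimplexCategory.mkOfSucc i) (SimplexCategory.const ⦋1⦌ ⦋0⦌ 0)
      (SimplexCategory.σ i) (SimplexCategory.const ⦋0⦌ ⦋n⦌ i) := by
  refine ⟨⟨?_⟩, ⟨PushoutCocone.IsColimit.mk _
    (fun c ↦ SimplexCategory.δ i.castSucc ≫ c.inl) (fun c ↦ ?_) (fun c ↦ ?_) ?_⟩⟩
  · ext k : 3
    fin_cases k
    · exact Fin.predAbove_castSucc_self i
    · exact Fin.predAbove_succ_self i
  · have h := c.condition
    have h0 : c.inl i.castSucc = c.inr 0 :=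
      congrArg (fun f : ⦋1⦌ ⟶ c.pt ↦ f 0) h
    have h1 : c.inl i.succ = c.inr 0 :=
      congrArg (fun f : ⦋1⦌ ⟶ c.pt ↦ f 1) h
    ext k : 3
    change c.inl (i.castSucc.succAbove (i.predAbove k)) = c.inl k
    by_cases hk : k = i.castSucc
    · rw [hk, Fin.predAbove_castSucc_self, Fin.succAbove_castSucc_self, h0, h1]
    · rw [Fin.succAbove_predAbove hk]
  · ext k : 3
    obtain rfl : k = 0 := Subsingleton.elim (α := Fin 1) _ _
    have h1 : c.inl i.succ = c.inr 0 :=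
      congrArg (fun f : ⦋1⦌ ⟶ c.pt ↦ f 1) c.condition
    change c.inl (i.castSucc.succAbove i) = c.inr 0
    rw [Fin.succAbove_castSucc_self, h1]
  · intro c m hm _
    rw [← hm, ← Category.assoc, SimplexCategory.δ_comp_σ_self, Category.id_comp]

theorem isInert_mkOfSucc {n : ℕ} (i : Fin n) : IsInert (SimplexCategory.mkOfSucc i) := by
  intro k
  obtain rfl : k = 0 := Subsingleton.elim (α := Fin 1) _ _
  rfl

theorem isActive_const_zero : IsActive (SimplexCategory.const ⦋1⦌ ⦋0⦌ 0) := ⟨rfl, rfl⟩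

/-- In a decomposition object each degeneracy map is a base change of `X _⦋0⦌ ⟶ X _⦋1⦌`. -/
theorem IsDecomp.isPullback_σ {X : SimplicialObject C} (hX : IsDecomp X) {n : ℕ}
    (i : Fin (n + 1)) :
    IsPullback (X.σ i) (X.map (SimplexCategory.const ⦋0⦌ ⦋n⦌ i).op)
      (X.map (SimplexCategory.mkOfSucc i).op)
      (X.map (SimplexCategory.const ⦋1⦌ ⦋0⦌ 0).op) :=
  hX _ _ _ _ (isInert_mkOfSucc i) isActive_const_zero (isPushout_mkOfSucc_σ i)

theorem mkOfSucc_comp_σ {n : ℕ} (i : Fin (n + 1)) (j : Fin (n + 2)) (hij : i.castSucc < j) :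
    SimplexCategory.mkOfSucc i.castSucc ≫ SimplexCategory.σ j = SimplexCategory.mkOfSucc i := by
  ext k : 3
  fin_cases k
  · exact Fin.predAbove_of_le_castSucc j i.castSucc.castSucc
      (Fin.castSucc_le_castSucc_iff.2 hij.le)
  · exact Fin.predAbove_of_le_castSucc j i.castSucc.succ
      (by simpa [Fin.le_def, Fin.lt_def, Nat.succ_le_iff] using hij)

theorem const_comp_σ {n : ℕ} (i j : Fin (n + 1)) (hij : i ≤ j) :
    SimplexCategory.const ⦋0⦌ ⦋n + 1⦌ i.castSucc ≫ SimplexCategory.σ j =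
      SimplexCategory.const ⦋0⦌ ⦋n⦌ i := by
  ext k : 3
  exact Fin.predAbove_of_le_castSucc j i.castSucc (Fin.castSucc_le_castSucc_iff.2 hij)

/-- The square of degeneracy maps given by the simplicial identity `σ_comp_σ` is a pullback. -/
theorem IsDecomp.isPullback_σ_σ {X : SimplicialObject C} (hX : IsDecomp X) {n : ℕ}
    {i j : Fin (n + 1)} (hij : i ≤ j) :
    IsPullback (X.σ j) (X.σ i) (X.σ i.castSucc) (X.σ j.succ) := by
  have houter := hX.isPullback_σ i
  rw [← mkOfSucc_comp_σ i j.succ (Fin.castSucc_lt_succ_iff.2 hij), ← const_comp_σ i j hij,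
    op_comp, op_comp, X.map_comp, X.map_comp] at houter
  exact (IsPullback.of_right houter.flip (X.σ_comp_σ hij)
    (hX.isPullback_σ i.castSucc).flip)

/-- In a decomposition object `X`, for all `i < j` the square of degeneracy maps
`(s_{j-1}, s_i; s_i, s_j)` is a pullback (whenever the maps are defined). -/
theorem degeneracy_squares_pullbacks (X : SimplicialObject C) (hX : IsDecomp X) :
    ∀ (n i j : ℕ) (_ : i < j) (_ : j ≤ n + 1),
      IsPullback (X.σ (⟨j - 1, by omega⟩ : Fin (n + 1))) (X.σ (⟨i, by omega⟩ : Fin (n + 1)))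
        (X.σ (⟨i, by omega⟩ : Fin (n + 2))) (X.σ (⟨j, by omega⟩ : Fin (n + 2))) := by
  intro n i j hij hj
  obtain ⟨j, rfl⟩ := Nat.exists_eq_succ_of_ne_zero (Nat.ne_of_gt (Nat.zero_lt_of_lt hij))
  exact hX.isPullback_σ_σ (i := ⟨i, by omega⟩) (j := ⟨j, by omega⟩) (Nat.le_of_lt_succ hij)
end
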